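/- (Davidson–Donsig.) Let κ ⊆ ℕ × ℕ. The following are equivalent: (i) κ is a Schur bounded pattern, i.e. every bounded function φ : ℕ × ℕ → ℂ vanishing outside κ is a Schur multiplier; (ii) there exist sets κ_r, κ_c ⊆ ℕ × ℕ and a number N ∈ ℕ such that κ = κ_r ∪ κ_c, each row of κ_r has at most N entries (i.e. for every i, the set {j : (i,j) ∈ κ_r} has at most N elements), and each column of κ_c has at most N entries (i.e. for every j, the set {i : (i,j) ∈ κ_c} has at most N elements). -/

import Mathlib

open scoped InnerProductSpace

noncomputable section

/-- The Hilbert space `ℓ² = ℓ²(ℕ, ℂ)`. -/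
abbrev l2 : Type := lp (fun _ : ℕ => ℂ) 2

/-- The standard orthonormal basis vector `e i` of `ℓ²`. -/
def e (i : ℕ) : l2 := lp.single 2 i 1

/-- The matrix entry `a(i,j) = ⟪A e_j, e_i⟫` of a bounded operator `A` on `ℓ²`. -/
def ent (A : l2 →L[ℂ] l2) (i j : ℕ) : ℂ := ⟪A (e j), e i⟫_ℂ

/-- A function `φ : ℕ × ℕ → ℂ` is a Schur multiplier if for every bounded operator `A` on
`ℓ²` there is a bounded operator on `ℓ²` whose matrix is `(φ(i,j) * a(i,j))`. -/
def IsSchurMultiplier (φ : ℕ × ℕ → ℂ) : Prop :=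
  ∀ A : l2 →L[ℂ] l2, ∃ B : l2 →L[ℂ] l2, ∀ i j, ent B i j = φ (i, j) * ent A i j

open Matrix

theorem resolv {n : ℕ} (X : Matrix (Fin n) (Fin n) ℝ) : ∃ G : Matrix (Fin n) (Fin n) ℝ,
  (1 + (1/2:ℝ) • (X * Xᵀ)) * G = 1 ∧ G * (1 + (1/2:ℝ) • (X * Xᵀ)) = 1 ∧ Gᵀ = G := by
  have h1 : (X * Xᵀ).PosSemidef := by
    simpa using Matrix.posSemidef_self_mul_conjTranspose X
  have h2 : (1 + (1/2:ℝ) • (X * Xᵀ)).PosDef :=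
    Matrix.PosDef.one.add_posSemidef (h1.smul (by norm_num))
  have h3 := (Matrix.isUnit_iff_isUnit_det _).1 h2.isUnit
  refine ⟨_, Matrix.mul_nonsing_inv _ h3, Matrix.nonsing_inv_mul _ h3, ?_⟩
  rw [Matrix.transpose_nonsing_inv]
  congr 1
  simp

theorem resolv_bd {n : ℕ} (X G : Matrix (Fin n) (Fin n) ℝ)
   (hG : (1 + (1/2:ℝ) • (X * Xᵀ)) * G = 1) (v : Fin n → ℝ) :
   2 * ((Xᵀ *ᵥ (G *ᵥ v)) ⬝ᵥ (Xᵀ *ᵥ (G *ᵥ v))) ≤ v ⬝ᵥ v := by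
  set h := G *ᵥ v with hh
  have hv : v = h + (1/2:ℝ) • ((X * Xᵀ) *ᵥ h) := by
    have : (1 + (1/2:ℝ) • (X * Xᵀ)) *ᵥ h = v := by
      rw [hh, Matrix.mulVec_mulVec, hG, Matrix.one_mulVec]
    rw [← this, Matrix.add_mulVec, Matrix.one_mulVec, Matrix.smul_mulVec]
  set q := (X * Xᵀ) *ᵥ h with hq
  have e1 : (Xᵀ *ᵥ h) ⬝ᵥ (Xᵀ *ᵥ h) = h ⬝ᵥ q := by
    rw [hq, ← Matrix.mulVec_mulVec, Matrix.dotProduct_mulVec h, ← Matrix.mulVec_transpose]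
  have e2 : 0 ≤ (h - (1/2:ℝ) • q) ⬝ᵥ (h - (1/2:ℝ) • q) :=
    Finset.sum_nonneg fun i _ => mul_self_nonneg _
  have e3 : q ⬝ᵥ h = h ⬝ᵥ q := dotProduct_comm _ _
  rw [e1, hv]
  simp only [add_dotProduct, dotProduct_add, sub_dotProduct, dotProduct_sub, smul_dotProduct, dotProduct_smul, smul_eq_mul] at *
  linarith

/-- truncation -/
theorem trunc {n : ℕ} (X : Matrix (Fin n) (Fin n) ℝ) : ∃ Y : Matrix (Fin n) (Fin n) ℝ,
   (∀ v, (Y *ᵥ v) ⬝ᵥ (Y *ᵥ v) ≤ v ⬝ᵥ v) ∧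
   (∀ i, ∑ j, (X i j - Y i j)^2 ≤ (1/8) * ∑ k, ((X * Xᵀ) i k)^2) ∧
   (∀ j, ∑ i, (X i j - Y i j)^2 ≤ (1/8) * ∑ k, ((Xᵀ * X) j k)^2) := by
  have key : ∀ X G : Matrix (Fin n) (Fin n) ℝ, (1 + (1/2:ℝ) • (X * Xᵀ)) * G = 1 →
     G * (1 + (1/2:ℝ) • (X * Xᵀ)) = 1 → Gᵀ = G → ∀ i, ∑ j, (X i j - (G * X) i j)^2 ≤ (1/8) * ∑ k, ((X * Xᵀ) i k)^2 := by
    intro X G h1 h2 h3 i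
    have := resolv_bd X G h1 ((X * Xᵀ) i)
    have e1 : X - G * X = (1/2:ℝ) • ((X * Xᵀ) * G * X) := by
      have : G = 1 - (1/2:ℝ) • ((X * Xᵀ) * G) := by
        rw [add_mul, one_mul, Matrix.smul_mul] at h1
        rw [← h1]; simp
      conv_lhs => rw [this]
      rw [sub_mul, one_mul, Matrix.smul_mul]; simp
    have e2 : ∀ j, X i j - (G * X) i j = (1/2) * (Xᵀ *ᵥ (G *ᵥ ((X * Xᵀ) i))) j := by
      intro j
      have := congrFun (congrFun e1 i) j
      rw [Matrix.sub_apply] at this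
      rw [this, Matrix.smul_apply, smul_eq_mul]
      congr 1
      rw [Matrix.mulVec_transpose]
      nth_rw 2 [← h3]
      rw [Matrix.mulVec_transpose, Matrix.vecMul_vecMul, Matrix.mul_assoc]
      rfl
    simp_rw [e2, mul_pow, ← Finset.mul_sum]
    simp only [dotProduct, ← pow_two] at this
    linarith
  obtain ⟨G, h1, h2, h3⟩ := resolv X
  obtain ⟨G', h1', h2', h3'⟩ := resolv Xᵀ
  have hY : (G * X)ᵀ = G' * Xᵀ := by
    rw [Matrix.transpose_mul, h3]
    rw [Matrix.transpose_transpose] at *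
    have : (1 + (1/2:ℝ) • (Xᵀ * X)) * Xᵀ = Xᵀ * (1 + (1/2:ℝ) • (X * Xᵀ)) := by
      simp [add_mul, mul_add, Matrix.mul_assoc]
    calc Xᵀ * G = (G' * (1 + (1/2:ℝ) • (Xᵀ * X))) * Xᵀ * G := by rw [h2', Matrix.one_mul]
      _ = G' * Xᵀ * ((1 + (1/2:ℝ) • (X * Xᵀ)) * G) := by
        rw [Matrix.mul_assoc G', this]; simp only [Matrix.mul_assoc]
      _ = _ := by rw [h1, Matrix.mul_one]
  refine ⟨G * X, ?_, key X G h1 h2 h3, ?_⟩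
  · intro v
    have := resolv_bd Xᵀ G' h1' v
    have e : G * X = X * G' := by
      have := congrArg Matrix.transpose hY
      simpa [h3'] using this
    rw [e, ← Matrix.mulVec_mulVec]
    rw [Matrix.transpose_transpose] at this
    have h0 : 0 ≤ (X *ᵥ (G' *ᵥ v)) ⬝ᵥ (X *ᵥ (G' *ᵥ v)) := Finset.sum_nonneg fun i _ => mul_self_nonneg _
    linarith
  · intro j
    have := key Xᵀ G' h1' h2' h3' j
    rw [← hY] at this
    simpa using this

abbrev Sg (n : ℕ) := Fin n → Fin n → ℤˣ

def sgv (u : ℤˣ) : ℝ := ((u : ℤ) : ℝ)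

theorem sgv_sq (u : ℤˣ) : sgv u * sgv u = 1 := by
  rcases Int.units_eq_one_or u with h | h <;> simp [sgv, h]

theorem sgv_abs (u : ℤˣ) : |sgv u| = 1 := by
  rcases Int.units_eq_one_or u with h | h <;> simp [sgv, h]

def rX {n : ℕ} (z : Matrix (Fin n) (Fin n) ℝ) (ε : Sg n) : Matrix (Fin n) (Fin n) ℝ :=
  fun i j => sgv (ε i j) * z i j

theorem sg_orth {n : ℕ} (i k j l : Fin n) (hik : k ≠ i) (hjl : j ≠ l) :
    ∑ ε : Sg n, sgv (ε i j) * sgv (ε k j) * (sgv (ε i l) * sgv (ε k l)) = 0 := by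
  let δ : Sg n := fun a b => if a = i ∧ b = j then -1 else 1
  have h := Equiv.sum_comp (Equiv.mulLeft δ)
    (fun ε : Sg n => sgv (ε i j) * sgv (ε k j) * (sgv (ε i l) * sgv (ε k l)))
  have h2 : ∀ ε : Sg n, sgv ((δ * ε) i j) * sgv ((δ * ε) k j) * (sgv ((δ * ε) i l) * sgv ((δ * ε) k l))
     = - (sgv (ε i j) * sgv (ε k j) * (sgv (ε i l) * sgv (ε k l))) := by
    intro ε
    simp [δ, hik, hjl.symm, sgv]
  simp only [Equiv.coe_mulLeft, h2, Finset.sum_neg_distrib] at h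
  linarith

theorem exp_row {n : ℕ} (z : Matrix (Fin n) (Fin n) ℝ) (hr : ∀ i, ∑ j, z i j ^ 2 ≤ 1)
    (hc : ∀ j, ∑ i, z i j ^ 2 ≤ 1) (i : Fin n) :
    ∑ ε : Sg n, ∑ k, ((rX z ε * (rX z ε)ᵀ) i k)^2 ≤ Fintype.card (Sg n) * 2 := by
  rw [Finset.sum_comm]
  have hk : ∀ k, k ≠ i → ∑ ε : Sg n, ((rX z ε * (rX z ε)ᵀ) i k)^2
      = Fintype.card (Sg n) * ∑ j, z i j ^ 2 * z k j ^ 2 := by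
    intro k hk
    have e1 : ∀ ε : Sg n, ((rX z ε * (rX z ε)ᵀ) i k)^2 = ∑ j, ∑ l, (z i j * z k j * (z i l * z k l)) *
        (sgv (ε i j) * sgv (ε k j) * (sgv (ε i l) * sgv (ε k l))) := by
      intro ε
      rw [Matrix.mul_apply, pow_two, Finset.sum_mul_sum]
      refine Finset.sum_congr rfl fun j _ => Finset.sum_congr rfl fun l _ => ?_
      simp only [rX, Matrix.transpose_apply]; ring
    simp_rw [e1]
    rw [Finset.sum_comm, Finset.mul_sum]
    refine Finset.sum_congr rfl fun j _ => ?_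
    rw [Finset.sum_comm, Finset.sum_eq_single j]
    · have : ∀ ε : Sg n, sgv (ε i j) * sgv (ε k j) * (sgv (ε i j) * sgv (ε k j)) = 1 := by
        intro ε
        linear_combination sgv_sq (ε i j) * (sgv (ε k j) * sgv (ε k j)) + sgv_sq (ε k j)
      simp_rw [this]
      simp
      ring
    · intro l _ hl
      rw [← Finset.mul_sum, sg_orth i k j l hk hl.symm, mul_zero]
    · simp
  have hi : ∑ ε : Sg n, ((rX z ε * (rX z ε)ᵀ) i i)^2 ≤ Fintype.card (Sg n) * 1 := by
    have : ∀ ε : Sg n, ((rX z ε * (rX z ε)ᵀ) i i)^2 ≤ 1 := by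
      intro ε
      have e : (rX z ε * (rX z ε)ᵀ) i i = ∑ j, z i j ^ 2 := by
        rw [Matrix.mul_apply]
        refine Finset.sum_congr rfl fun j _ => ?_
        simp only [rX, Matrix.transpose_apply]
        linear_combination sgv_sq (ε i j) * z i j ^ 2
      rw [e]
      exact pow_le_one₀ (Finset.sum_nonneg fun j _ => sq_nonneg _) (hr i)
    refine (Finset.sum_le_sum fun ε _ => this ε).trans ?_
    simp
  rw [← Finset.add_sum_erase _ _ (Finset.mem_univ i)]
  have h3 : ∑ k ∈ Finset.univ.erase i, ∑ ε : Sg n, ((rX z ε * (rX z ε)ᵀ) i k)^2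
     ≤ Fintype.card (Sg n) * 1 := by
    rw [Finset.sum_congr rfl fun k hk' => hk k (Finset.ne_of_mem_erase hk'), ← Finset.mul_sum]
    gcongr
    calc ∑ k ∈ Finset.univ.erase i, ∑ j, z i j ^ 2 * z k j ^ 2
        ≤ ∑ k, ∑ j, z i j ^ 2 * z k j ^ 2 :=
          Finset.sum_le_sum_of_subset_of_nonneg (Finset.subset_univ _)
            fun k _ _ => Finset.sum_nonneg fun j _ => by positivity
      _ = ∑ j, z i j ^ 2 * ∑ k, z k j ^ 2 := by
          rw [Finset.sum_comm]; simp_rw [Finset.mul_sum]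
      _ ≤ ∑ j, z i j ^ 2 * 1 := by
          gcongr with j _; exact hc j
      _ ≤ 1 := by simpa using hr i
  linarith

theorem exp_col {n : ℕ} (z : Matrix (Fin n) (Fin n) ℝ) (hr : ∀ i, ∑ j, z i j ^ 2 ≤ 1)
    (hc : ∀ j, ∑ i, z i j ^ 2 ≤ 1) (i : Fin n) :
    ∑ ε : Sg n, ∑ k, (((rX z ε)ᵀ * rX z ε) i k)^2 ≤ Fintype.card (Sg n) * 2 := by
  have h := exp_row zᵀ hc hr i
  rw [← Equiv.sum_comp (Equiv.piComm (fun _ _ : Fin n => ℤˣ))] at h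
  exact h

/-- uniform multiplier bound on finite real sections -/
def HypM (κ : Set (ℕ × ℕ)) (M : ℝ) : Prop :=
  ∀ (n : ℕ) (s : Fin n → Fin n → ℝ), (∀ i j, |s i j| ≤ 1) →
    (∀ i j : Fin n, ((i : ℕ), (j : ℕ)) ∉ κ → s i j = 0) →
    ∀ Y : Matrix (Fin n) (Fin n) ℝ, (∀ v, (Y *ᵥ v) ⬝ᵥ (Y *ᵥ v) ≤ v ⬝ᵥ v) →
    ∀ x y : Fin n → ℝ, ∑ i, x i ^ 2 ≤ 1 → ∑ i, y i ^ 2 ≤ 1 →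
      ∑ i, ∑ j, x i * (s i j * Y i j) * y j ≤ M

def HypQ (κ : Set (ℕ × ℕ)) (n : ℕ) (L : ℝ) : Prop :=
  ∀ z : Matrix (Fin n) (Fin n) ℝ, (∀ i, ∑ j, z i j ^ 2 ≤ 1) → (∀ j, ∑ i, z i j ^ 2 ≤ 1) →
    (∀ i j : Fin n, ((i : ℕ), (j : ℕ)) ∉ κ → z i j = 0) →
    ∀ x y : Fin n → ℝ, ∑ i, x i ^ 2 ≤ 1 → ∑ i, y i ^ 2 ≤ 1 →
      ∑ i, ∑ j, x i * z i j * y j ≤ L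

open Classical in
theorem stepQ (κ : Set (ℕ × ℕ)) (M : ℝ) (hM : HypM κ M) (n : ℕ) (L : ℝ) (hL : HypQ κ n L) :
    HypQ κ n (M + L / 2) := by
  intro z hr hc hz x y hx hy
  choose Y hY1 hY2 hY3 using fun ε : Sg n => trunc (rX z ε)
  set c : ℝ := (Fintype.card (Sg n) : ℝ) with hcdef
  have hc0 : 0 < c := by
    rw [hcdef]; exact_mod_cast Fintype.card_pos
  let s : Sg n → Fin n → Fin n → ℝ := fun ε i j =>
    if ((i : ℕ), (j : ℕ)) ∈ κ then sgv (ε i j) else 0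
  let z' : Matrix (Fin n) (Fin n) ℝ := fun i j => z i j - c⁻¹ * ∑ ε, s ε i j * Y ε i j
  have hz' : ∀ i j, z' i j ^ 2 ≤ c⁻¹ * ∑ ε, (rX z ε i j - Y ε i j) ^ 2 := by
    intro i j
    by_cases h : ((i : ℕ), (j : ℕ)) ∈ κ
    · have e : z' i j = c⁻¹ * ∑ ε : Sg n, sgv (ε i j) * (rX z ε i j - Y ε i j) := by
        have : ∀ ε : Sg n, sgv (ε i j) * (rX z ε i j - Y ε i j) = z i j - s ε i j * Y ε i j := by
          intro ε
          simp only [s, h, if_true, rX]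
          linear_combination sgv_sq (ε i j) * z i j
        simp_rw [this, Finset.sum_sub_distrib]
        simp only [z', Finset.sum_const, Finset.card_univ, nsmul_eq_mul, ← hcdef]
        field_simp
      have h2 : (∑ ε : Sg n, sgv (ε i j) * (rX z ε i j - Y ε i j)) ^ 2
          ≤ c * ∑ ε : Sg n, (rX z ε i j - Y ε i j) ^ 2 := by
        refine sq_sum_le_card_mul_sum_sq.trans (le_of_eq ?_)
        rw [Finset.card_univ]
        congr 1
        refine Finset.sum_congr rfl fun ε _ => ?_
        linear_combination sgv_sq (ε i j) * (rX z ε i j - Y ε i j) ^ 2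
      rw [e, mul_pow]
      calc _ ≤ c⁻¹ ^ 2 * (c * ∑ ε : Sg n, (rX z ε i j - Y ε i j) ^ 2) := by gcongr
        _ = _ := by field_simp
    · have : z' i j = 0 := by simp [z', s, h, hz i j h]
      rw [this]
      have : 0 ≤ ∑ ε : Sg n, (rX z ε i j - Y ε i j) ^ 2 := Finset.sum_nonneg fun _ _ => sq_nonneg _
      simp; positivity
  have hr' : ∀ i, ∑ j, z' i j ^ 2 ≤ 1 / 4 := by
    intro i
    calc ∑ j, z' i j ^ 2 ≤ ∑ j, c⁻¹ * ∑ ε, (rX z ε i j - Y ε i j) ^ 2 :=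
          Finset.sum_le_sum fun j _ => hz' i j
      _ = c⁻¹ * ∑ ε, ∑ j, (rX z ε i j - Y ε i j) ^ 2 := by
          rw [← Finset.mul_sum, Finset.sum_comm]
      _ ≤ c⁻¹ * ∑ ε, (1/8) * ∑ k, ((rX z ε * (rX z ε)ᵀ) i k)^2 := by
          gcongr with ε _; exact hY2 ε i
      _ ≤ c⁻¹ * ((1/8) * (c * 2)) := by
          rw [← Finset.mul_sum]; gcongr; exact exp_row z hr hc i
      _ = 1/4 := by field_simp; norm_num
  have hc' : ∀ j, ∑ i, z' i j ^ 2 ≤ 1 / 4 := by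
    intro j
    calc ∑ i, z' i j ^ 2 ≤ ∑ i, c⁻¹ * ∑ ε, (rX z ε i j - Y ε i j) ^ 2 :=
          Finset.sum_le_sum fun i _ => hz' i j
      _ = c⁻¹ * ∑ ε, ∑ i, (rX z ε i j - Y ε i j) ^ 2 := by
          rw [← Finset.mul_sum, Finset.sum_comm]
      _ ≤ c⁻¹ * ∑ ε, (1/8) * ∑ k, (((rX z ε)ᵀ * rX z ε) j k)^2 := by
          gcongr with ε _; exact hY3 ε j
      _ ≤ c⁻¹ * ((1/8) * (c * 2)) := by
          rw [← Finset.mul_sum]; gcongr; exact exp_col z hr hc j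
      _ = 1/4 := by field_simp; norm_num
  have h1 := hL ((2:ℝ) • z')
    (by intro i; simp only [Matrix.smul_apply, smul_eq_mul, mul_pow, ← Finset.mul_sum]; linarith [hr' i])
    (by intro i; simp only [Matrix.smul_apply, smul_eq_mul, mul_pow, ← Finset.mul_sum]; linarith [hc' i])
    (by intro i j h; rw [Matrix.smul_apply]; simp [z', s, h, hz i j h]) x y hx hy
  have h2 : ∑ i, ∑ j, x i * ((2:ℝ) • z') i j * y j = 2 * ∑ i, ∑ j, x i * z' i j * y j := by
    simp only [Finset.mul_sum, Matrix.smul_apply, smul_eq_mul]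
    refine Finset.sum_congr rfl fun j _ => Finset.sum_congr rfl fun l _ => ?_
    ring
  have h3 : ∑ ε, ∑ i, ∑ j, x i * (s ε i j * Y ε i j) * y j ≤ c * M := by
    calc _ ≤ ∑ ε : Sg n, M := Finset.sum_le_sum fun ε _ => hM n (s ε) ?_ ?_ (Y ε) (hY1 ε) x y hx hy
      _ = c * M := by simp [hcdef]
    · intro i j
      simp only [s]; split_ifs
      · exact (sgv_abs _).le
      · simp
    · intro i j h; simp [s, h]
  have h4 : ∑ i, ∑ j, x i * z i j * y j = ∑ i, ∑ j, x i * z' i j * y j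
     + c⁻¹ * ∑ ε, ∑ i, ∑ j, x i * (s ε i j * Y ε i j) * y j := by
    rw [Finset.sum_comm (s := (Finset.univ : Finset (Sg n))), Finset.mul_sum, ← Finset.sum_add_distrib]
    refine Finset.sum_congr rfl fun i _ => ?_
    rw [Finset.sum_comm (s := (Finset.univ : Finset (Sg n))), Finset.mul_sum, ← Finset.sum_add_distrib]
    refine Finset.sum_congr rfl fun j _ => ?_
    have : ∑ ε : Sg n, x i * (s ε i j * Y ε i j) * y j = x i * (∑ ε, s ε i j * Y ε i j) * y j := by
      rw [Finset.mul_sum, Finset.sum_mul]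
    rw [this]; simp only [z']; ring
  have h5 : c⁻¹ * ∑ ε, ∑ i, ∑ j, x i * (s ε i j * Y ε i j) * y j ≤ M := by
    calc _ ≤ c⁻¹ * (c * M) := by gcongr
      _ = M := by field_simp
  rw [h4]; linarith

theorem baseQ (κ : Set (ℕ × ℕ)) (n : ℕ) : HypQ κ n (n * n) := by
  intro z hr hc hz x y hx hy
  have h1 : ∀ i j, x i * z i j * y j ≤ 1 := by
    intro i j
    have a1 : x i ^ 2 ≤ 1 := (Finset.single_le_sum (f := fun i => x i ^ 2) (fun _ _ => sq_nonneg _) (Finset.mem_univ i)).trans hx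
    have a2 : y j ^ 2 ≤ 1 := (Finset.single_le_sum (f := fun i => y i ^ 2) (fun _ _ => sq_nonneg _) (Finset.mem_univ j)).trans hy
    have a3 : z i j ^ 2 ≤ 1 := (Finset.single_le_sum (f := fun j => z i j ^ 2) (fun _ _ => sq_nonneg _) (Finset.mem_univ j)).trans (hr i)
    rw [sq_le_one_iff_abs_le_one] at a1 a2 a3
    refine (le_abs_self _).trans ?_
    rw [abs_mul, abs_mul]
    exact mul_le_one₀ (mul_le_one₀ a1 (abs_nonneg _) a3) (abs_nonneg _) a2
  refine (Finset.sum_le_sum fun i _ => Finset.sum_le_sum fun j _ => h1 i j).trans ?_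
  simp

theorem limQ (κ : Set (ℕ × ℕ)) (M : ℝ) (hM : HypM κ M) (n : ℕ) : HypQ κ n (2 * M) := by
  have h : ∀ k : ℕ, HypQ κ n (2 * M + (n * n - 2 * M) * (1/2)^k) := by
    intro k
    induction k with
    | zero => simpa using baseQ κ n
    | succ k ih =>
      have := stepQ κ M hM n _ ih
      convert this using 1
      ring
  intro z hr hc hz x y hx hy
  have ht : Filter.Tendsto (fun k : ℕ => 2 * M + ((n:ℝ) * n - 2 * M) * (1/2)^k) Filter.atTop
      (nhds (2 * M + ((n:ℝ) * n - 2 * M) * 0)) :=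
    ((tendsto_pow_atTop_nhds_zero_of_lt_one (by norm_num) (by norm_num)).const_mul _).const_add _
  rw [mul_zero, add_zero] at ht
  exact ge_of_tendsto' ht fun k => h k z hr hc hz x y hx hy

def rd (H : Finset (ℕ × ℕ)) (i : ℕ) : ℕ := (H.filter (fun p => p.1 = i)).card
def cd (H : Finset (ℕ × ℕ)) (j : ℕ) : ℕ := (H.filter (fun p => p.2 = j)).card

theorem dsum (H : Finset (ℕ × ℕ)) (n : ℕ) (hn : ∀ p ∈ H, p.1 < n ∧ p.2 < n) (f : ℕ × ℕ → ℝ) :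
    ∑ i : Fin n, ∑ j : Fin n, (if ((i:ℕ), (j:ℕ)) ∈ H then f (i, j) else 0) = ∑ p ∈ H, f p := by
  rw [← Finset.sum_range (fun i => ∑ j : Fin n, (if (i, (j:ℕ)) ∈ H then f (i, j) else 0))]
  simp_rw [← fun i : ℕ => Finset.sum_range (n := n) (fun j => (if (i, j) ∈ H then f (i, j) else 0))]
  rw [← Finset.sum_product' (f := fun i j => (if (i, j) ∈ H then f (i, j) else 0))]
  rw [Finset.sum_ite_mem]
  congr 1
  ext p
  simp only [Finset.mem_inter, Finset.mem_product, Finset.mem_range]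
  exact ⟨fun h => h.2, fun h => ⟨hn p h, h⟩⟩

theorem rsum (H : Finset (ℕ × ℕ)) (n : ℕ) (hn : ∀ p ∈ H, p.1 < n ∧ p.2 < n) (i : ℕ) :
    ∑ j : Fin n, (if (i, (j:ℕ)) ∈ H then (1:ℝ) else 0) = rd H i := by
  rw [← Finset.sum_range (fun j => (if (i, (j:ℕ)) ∈ H then (1:ℝ) else 0)), Finset.sum_boole]
  norm_cast
  refine Finset.card_bij (fun j _ => (i, j)) ?_ ?_ ?_
  · intro j hj; simp at hj ⊢; exact hj.2
  · intro a _ b _ h; simpa using h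
  · intro p hp
    simp only [Finset.mem_filter] at hp
    refine ⟨p.2, ?_, ?_⟩
    · simp [hn p hp.1, ← hp.2, hp.1]
    · rw [← hp.2]

theorem csum (H : Finset (ℕ × ℕ)) (n : ℕ) (hn : ∀ p ∈ H, p.1 < n ∧ p.2 < n) (j : ℕ) :
    ∑ i : Fin n, (if ((i:ℕ), j) ∈ H then (1:ℝ) else 0) = cd H j := by
  rw [← Finset.sum_range (fun i => (if ((i:ℕ), j) ∈ H then (1:ℝ) else 0)), Finset.sum_boole]
  norm_cast
  refine Finset.card_bij (fun i _ => (i, j)) ?_ ?_ ?_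
  · intro j hj; simp at hj ⊢; exact hj.2
  · intro a _ b _ h; simpa using h
  · intro p hp
    simp only [Finset.mem_filter] at hp
    refine ⟨p.1, ?_, ?_⟩
    · simp [hn p hp.1, ← hp.2, hp.1]
    · rw [← hp.2]

theorem lowdeg (κ : Set (ℕ × ℕ)) (L : ℝ) (hQ : ∀ n, HypQ κ n L) :
    ∃ K : ℕ, ∀ H : Finset (ℕ × ℕ), (∀ p ∈ H, p ∈ κ) → H.Nonempty →
      (∃ i, 0 < rd H i ∧ rd H i ≤ K) ∨ (∃ j, 0 < cd H j ∧ cd H j ≤ K) := by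
  obtain ⟨K, hK⟩ := exists_nat_ge (2 * L ^ 2)
  refine ⟨K, fun H hH hne => ?_⟩
  by_contra! hcon
  obtain ⟨hcr, hcc⟩ := hcon
  obtain ⟨n, hn⟩ : ∃ n, ∀ p ∈ H, p.1 < n ∧ p.2 < n := by
    refine ⟨H.sup (fun p => p.1 + p.2) + 1, fun p hp => ?_⟩
    have := Finset.le_sup (f := fun p : ℕ × ℕ => p.1 + p.2) hp
    have : p.1 + p.2 ≤ H.sup (fun p => p.1 + p.2) := this
    omega
  have hrp : ∀ p ∈ H, (K:ℝ) + 1 ≤ rd H p.1 := by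
    intro p hp
    have : 0 < rd H p.1 := Finset.card_pos.2 ⟨p, by simp [hp]⟩
    exact_mod_cast hcr _ this
  have hcp : ∀ p ∈ H, (K:ℝ) + 1 ≤ cd H p.2 := by
    intro p hp
    have : 0 < cd H p.2 := Finset.card_pos.2 ⟨p, by simp [hp]⟩
    exact_mod_cast hcc _ this
  have hK0 : (0:ℝ) ≤ K := Nat.cast_nonneg _
  set E : ℝ := (H.card : ℝ) with hE
  have hE0 : 0 < E := by rw [hE]; exact_mod_cast hne.card_pos
  let z : Matrix (Fin n) (Fin n) ℝ := fun i j =>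
    if ((i:ℕ), (j:ℕ)) ∈ H then 1 / √((rd H i : ℝ) + cd H j) else 0
  have hz2 : ∀ i j, z i j ^ 2 = if ((i:ℕ), (j:ℕ)) ∈ H then 1 / ((rd H i : ℝ) + cd H j) else 0 := by
    intro i j
    simp only [z]; split_ifs
    · rw [div_pow, Real.sq_sqrt (by positivity), one_pow]
    · simp
  have hx : ∑ i : Fin n, (√(rd H i : ℝ) / √E) ^ 2 ≤ 1 := by
    simp_rw [div_pow]
    rw [← Finset.sum_div, Real.sq_sqrt hE0.le, div_le_one hE0]
    have := dsum H n hn (fun _ => 1)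
    simp_rw [rsum H n hn] at this
    simp_rw [Real.sq_sqrt (Nat.cast_nonneg _)]
    rw [this]; simp [hE]
  have hy : ∑ i : Fin n, (√(cd H i : ℝ) / √E) ^ 2 ≤ 1 := by
    simp_rw [div_pow]
    rw [← Finset.sum_div, Real.sq_sqrt hE0.le, div_le_one hE0]
    have := dsum H n hn (fun _ => 1)
    rw [Finset.sum_comm] at this
    simp_rw [csum H n hn] at this
    simp_rw [Real.sq_sqrt (Nat.cast_nonneg _)]
    rw [this]; simp [hE]
  have h := hQ n z ?_ ?_ ?_ _ _ hx hy
  · have e1 : ∀ i j : Fin n, √(rd H i : ℝ) / √E * z i j * (√(cd H j : ℝ) / √E) =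
       E⁻¹ * (if ((i:ℕ), (j:ℕ)) ∈ H then √((rd H i : ℝ) * cd H j / (rd H i + cd H j)) else 0) := by
      intro i j
      simp only [z]; split_ifs
      · rw [Real.sqrt_div (by positivity), Real.sqrt_mul (by positivity)]
        have : E⁻¹ = 1 / √E * (1 / √E) := by
          rw [div_mul_div_comm, Real.mul_self_sqrt hE0.le]; simp
        rw [this]; ring
      · simp
    simp_rw [e1, ← Finset.mul_sum] at h
    rw [dsum H n hn (fun p => √((rd H p.1 : ℝ) * cd H p.2 / (rd H p.1 + cd H p.2)))] at h
    have h2 : E * √(((K:ℝ) + 1) / 2) ≤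
        ∑ p ∈ H, √((rd H p.1 : ℝ) * cd H p.2 / (rd H p.1 + cd H p.2)) := by
      rw [hE, ← nsmul_eq_mul]
      refine Finset.card_nsmul_le_sum _ _ _ fun p hp => Real.sqrt_le_sqrt ?_
      have a := hrp p hp
      have b := hcp p hp
      rw [div_le_div_iff₀ (by norm_num) (by linarith)]
      nlinarith [mul_nonneg (sub_nonneg.2 a) (by linarith : (0:ℝ) ≤ cd H p.2),
        mul_nonneg (sub_nonneg.2 b) (by linarith : (0:ℝ) ≤ rd H p.1)]
    have h3 : √(((K:ℝ) + 1) / 2) ≤ L := by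
      refine le_trans ?_ h
      rw [inv_mul_eq_div, le_div_iff₀ hE0]; linarith
    have h4 : ((K:ℝ) + 1) / 2 ≤ L ^ 2 := (Real.sqrt_le_left (le_trans (Real.sqrt_nonneg _) h3)).1 h3
    linarith
  · intro i
    have : ∀ j : Fin n, z i j ^ 2 ≤ (if ((i:ℕ), (j:ℕ)) ∈ H then (1:ℝ) else 0) * (1 / (rd H i : ℝ)) := by
      intro j
      rw [hz2]; split_ifs with hij
      · have := hrp _ hij
        rw [one_mul]
        exact one_div_le_one_div_of_le (by linarith) (by simp)
      · simp
    refine (Finset.sum_le_sum fun j _ => this j).trans ?_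
    rw [← Finset.sum_mul, rsum H n hn, mul_one_div]
    exact div_self_le_one _
  · intro j
    have : ∀ i : Fin n, z i j ^ 2 ≤ (if ((i:ℕ), (j:ℕ)) ∈ H then (1:ℝ) else 0) * (1 / (cd H j : ℝ)) := by
      intro i
      rw [hz2]; split_ifs with hij
      · have := hcp _ hij
        rw [one_mul]
        exact one_div_le_one_div_of_le (by linarith) (by simp)
      · simp
    refine (Finset.sum_le_sum fun j _ => this j).trans ?_
    rw [← Finset.sum_mul, csum H n hn, mul_one_div]
    exact div_self_le_one _
  · intro i j hij
    simp only [z]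
    rw [if_neg fun h => hij (hH _ h)]

theorem decomp (κ : Set (ℕ × ℕ)) (K : ℕ)
    (hK : ∀ H : Finset (ℕ × ℕ), (∀ p ∈ H, p ∈ κ) → H.Nonempty →
      (∃ i, 0 < rd H i ∧ rd H i ≤ K) ∨ (∃ j, 0 < cd H j ∧ cd H j ≤ K)) :
    ∀ (m : ℕ) (H : Finset (ℕ × ℕ)), H.card = m → (∀ p ∈ H, p ∈ κ) →
      ∃ r c : Finset (ℕ × ℕ), H = r ∪ c ∧ (∀ i, rd r i ≤ K) ∧ (∀ j, cd c j ≤ K) := by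
  intro m
  induction m using Nat.strong_induction_on with
  | _ m ih =>
  intro H hm hH
  rcases H.eq_empty_or_nonempty with h0 | hne
  · exact ⟨∅, ∅, by simp [h0], by simp [rd], by simp [cd]⟩
  rcases hK H hH hne with ⟨i, hi0, hi⟩ | ⟨j, hj0, hj⟩
  · have hsplit := Finset.card_filter_add_card_filter_not (s := H) (fun p => p.1 = i)
    unfold rd at hi0 hi
    obtain ⟨r, c, hrc, hr, hc⟩ := ih _ (by omega) (H.filter (fun p => ¬ p.1 = i)) rfl
      (fun p hp => hH p (Finset.mem_filter.1 hp).1)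
    refine ⟨r ∪ H.filter (fun p => p.1 = i), c, ?_, ?_, hc⟩
    · rw [Finset.union_right_comm, ← hrc, Finset.union_comm, Finset.filter_union_filter_not_eq]
    · intro k
      by_cases hk : k = i
      · subst hk
        refine le_trans (Finset.card_le_card ?_) hi
        intro p hp
        simp only [Finset.mem_filter, Finset.mem_union] at hp ⊢
        refine ⟨?_, hp.2⟩
        rcases hp.1 with h | h
        · have : p ∈ r ∪ c := Finset.mem_union_left _ h
          rw [← hrc] at this
          exact (Finset.mem_filter.1 this).1
        · exact h.1
      · refine le_trans (Finset.card_le_card ?_) (hr k)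
        intro p hp
        simp only [Finset.mem_filter, Finset.mem_union] at hp ⊢
        refine ⟨?_, hp.2⟩
        rcases hp.1 with h | h
        · exact h
        · exact absurd (hp.2.symm.trans h.2) hk
  · have hsplit := Finset.card_filter_add_card_filter_not (s := H) (fun p => p.2 = j)
    unfold cd at hj0 hj
    obtain ⟨r, c, hrc, hr, hc⟩ := ih _ (by omega) (H.filter (fun p => ¬ p.2 = j)) rfl
      (fun p hp => hH p (Finset.mem_filter.1 hp).1)
    refine ⟨r, c ∪ H.filter (fun p => p.2 = j), ?_, hr, ?_⟩
    · rw [← Finset.union_assoc, ← hrc, Finset.union_comm, Finset.filter_union_filter_not_eq]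
    · intro k
      by_cases hk : k = j
      · subst hk
        refine le_trans (Finset.card_le_card ?_) hj
        intro p hp
        simp only [Finset.mem_filter, Finset.mem_union] at hp ⊢
        refine ⟨?_, hp.2⟩
        rcases hp.1 with h | h
        · have : p ∈ r ∪ c := Finset.mem_union_right _ h
          rw [← hrc] at this
          exact (Finset.mem_filter.1 this).1
        · exact h.1
      · refine le_trans (Finset.card_le_card ?_) (hc k)
        intro p hp
        simp only [Finset.mem_filter, Finset.mem_union] at hp ⊢
        refine ⟨?_, hp.2⟩
        rcases hp.1 with h | h
        · exact h
        · exact absurd (hp.2.symm.trans h.2) hk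

theorem encard_bd (S : Set ℕ) (K : ℕ) (h : ∀ F : Finset ℕ, (∀ a ∈ F, a ∈ S) → F.card ≤ K) :
    S.encard ≤ K := by
  by_contra! hlt
  obtain ⟨t, ht, htc⟩ := Set.exists_subset_encard_eq (Order.add_one_le_of_lt hlt)
  have hfin : t.Finite := Set.finite_of_encard_eq_coe (k := K + 1) (by rw [htc]; norm_cast)
  have := h hfin.toFinset (fun a ha => ht (by simpa using ha))
  rw [hfin.encard_eq_coe_toFinset_card] at htc
  have : hfin.toFinset.card = K + 1 := by exact_mod_cast htc
  omega

open Classical in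
theorem compactness (κ : Set (ℕ × ℕ)) (K : ℕ)
    (h : ∀ H : Finset (ℕ × ℕ), (∀ p ∈ H, p ∈ κ) →
      ∃ r c : Finset (ℕ × ℕ), H = r ∪ c ∧ (∀ i, rd r i ≤ K) ∧ (∀ j, cd c j ≤ K)) :
    ∃ (κr κc : Set (ℕ × ℕ)) (N : ℕ), κ = κr ∪ κc ∧
        (∀ i, {j | (i, j) ∈ κr}.encard ≤ N) ∧
        (∀ j, {i | (i, j) ∈ κc}.encard ≤ N) := by
  choose r c hrc hr hc using fun n : ℕ =>
    h ((Finset.range n ×ˢ Finset.range n).filter (· ∈ κ)) (fun p hp => (Finset.mem_filter.1 hp).2)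
  have hsub : ∀ n p, p ∈ r n ∪ c n → p ∈ κ := fun n p hp => by
    rw [← hrc] at hp; exact (Finset.mem_filter.1 hp).2
  let U := Filter.hyperfilter ℕ
  refine ⟨{p | ∀ᶠ n in U, p ∈ r n}, {p | ∀ᶠ n in U, p ∈ c n}, K, ?_, ?_, ?_⟩
  · ext p
    constructor
    · intro hp
      have : ∀ᶠ n in U, p ∈ r n ∨ p ∈ c n := by
        have h1 : ∀ᶠ n in Filter.atTop, p ∈ r n ∨ p ∈ c n := by
          filter_upwards [Filter.eventually_gt_atTop (p.1 + p.2)] with n hn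
          rw [← Finset.mem_union, ← hrc]
          simp only [Finset.mem_filter, Finset.mem_product, Finset.mem_range]
          exact ⟨⟨by omega, by omega⟩, hp⟩
        exact Nat.hyperfilter_le_atTop h1
      exact Ultrafilter.eventually_or.1 this
    · rintro (hp | hp)
      · obtain ⟨n, hn⟩ := Filter.Eventually.exists hp
        exact hsub n p (Finset.mem_union_left _ hn)
      · obtain ⟨n, hn⟩ := Filter.Eventually.exists hp
        exact hsub n p (Finset.mem_union_right _ hn)
  · intro i
    refine encard_bd _ _ fun F hF => ?_
    have : ∀ᶠ n in U, ∀ a ∈ F, (i, a) ∈ r n := (Filter.eventually_all_finset F).2 hF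
    obtain ⟨n, hn⟩ := this.exists
    refine le_trans ?_ (hr n i)
    refine Finset.card_le_card_of_injOn (fun a => (i, a)) ?_ ?_
    · intro a ha; simpa using hn a ha
    · intro a _ b _ hab; simpa using hab
  · intro i
    refine encard_bd _ _ fun F hF => ?_
    have : ∀ᶠ n in U, ∀ a ∈ F, (a, i) ∈ c n := (Filter.eventually_all_finset F).2 hF
    obtain ⟨n, hn⟩ := this.exists
    refine le_trans ?_ (hc n i)
    refine Finset.card_le_card_of_injOn (fun a => (a, i)) ?_ ?_
    · intro a ha; simpa using hn a ha
    · intro a _ b _ hab; simpa using hab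

theorem ent_eq (A : l2 →L[ℂ] l2) (i j : ℕ) : ent A i j = (starRingEnd ℂ) ((A (e j) : l2) i) := by
  unfold ent
  conv_lhs => rw [e.eq_def i]
  rw [lp.inner_single_right]
  simp

theorem e_apply (i j : ℕ) : (e j : l2) i = if i = j then 1 else 0 := by
  simp [e, lp.single_apply, Pi.single_apply]

theorem sumsq_le (x : l2) (s : Finset ℕ) : ∑ i ∈ s, ‖x i‖ ^ 2 ≤ ‖x‖ ^ 2 := by
  have := lp.sum_rpow_le_norm_rpow (p := 2) (by norm_num) x s
  simpa using this

theorem norm_e (j : ℕ) : ‖e j‖ = 1 := by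
  simp [e, lp.norm_single]

theorem mkop (b : ℕ → ℕ → ℂ) (R : ℕ → Finset ℕ) (hR : ∀ i j, j ∉ R i → b i j = 0) (C : ℝ)
    (hC : 0 ≤ C)
    (h : ∀ x : l2, ∀ s : Finset ℕ, ∑ i ∈ s, ‖∑ j ∈ R i, b i j * x j‖ ^ 2 ≤ (C * ‖x‖) ^ 2) :
    ∃ B : l2 →L[ℂ] l2, ‖B‖ ≤ C ∧ ∀ i j, (B (e j) : l2) i = b i j := by
  have hm : ∀ x : l2, Memℓp (fun i => ∑ j ∈ R i, b i j * x j) 2 := fun x =>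
    memℓp_gen' (C := (C * ‖x‖) ^ 2) (by simpa using h x)
  let T : l2 →ₗ[ℂ] l2 :=
    { toFun := fun x => ⟨fun i => ∑ j ∈ R i, b i j * x j, hm x⟩
      map_add' := by
        intro x y
        ext i
        simp [mul_add, Finset.sum_add_distrib]
        rfl
      map_smul' := by
        intro c x
        ext i
        simp [Finset.mul_sum, mul_left_comm] }
  have hT : ∀ x i, (T x : l2) i = ∑ j ∈ R i, b i j * x j := fun x i => rfl
  refine ⟨T.mkContinuous C ?_, LinearMap.mkContinuous_norm_le _ hC _, ?_⟩
  · intro x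
    refine lp.norm_le_of_forall_sum_le (by norm_num) (by positivity) ?_
    intro s
    simpa [hT] using h x s
  · intro i j
    rw [LinearMap.mkContinuous_apply, hT]
    simp only [e_apply, mul_ite, mul_one, mul_zero]
    rw [Finset.sum_ite_eq']
    split_ifs with hj
    · rfl
    · exact (hR i j hj).symm

theorem row_schur (φ : ℕ × ℕ → ℂ) (C : ℝ) (hφ : ∀ p, ‖φ p‖ ≤ C) (N : ℕ)
    (hN : ∀ i, {j | φ (i, j) ≠ 0}.encard ≤ N) : IsSchurMultiplier φ := by
  intro A
  have hC0 : 0 ≤ C := (norm_nonneg _).trans (hφ (0, 0))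
  have hfin : ∀ i, {j | φ (i, j) ≠ 0}.Finite := fun i =>
    Set.finite_of_encard_le_coe (hN i)
  have hcard : ∀ i, (hfin i).toFinset.card ≤ N := by
    intro i
    have := hN i
    rw [(hfin i).encard_eq_coe_toFinset_card] at this
    exact_mod_cast this
  have key : ∀ x : l2, ∀ s : Finset ℕ, ∑ i ∈ s, ‖∑ j ∈ (hfin i).toFinset,
      (starRingEnd ℂ) (φ (i, j)) * (A (e j) : l2) i * x j‖ ^ 2 ≤ (√N * C * ‖A‖ * ‖x‖) ^ 2 := by
    intro x s
    set R := fun i => (hfin i).toFinset with hRdef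
    calc ∑ i ∈ s, ‖∑ j ∈ R i, (starRingEnd ℂ) (φ (i, j)) * (A (e j) : l2) i * x j‖ ^ 2
        ≤ ∑ i ∈ s, N * ∑ j ∈ R i, C ^ 2 * (‖(A (e j) : l2) i‖ ^ 2 * ‖x j‖ ^ 2) := by
          refine Finset.sum_le_sum fun i _ => ?_
          calc _ ≤ (∑ j ∈ R i, ‖(starRingEnd ℂ) (φ (i, j)) * (A (e j) : l2) i * x j‖) ^ 2 := by
                gcongr; exact norm_sum_le _ _
            _ ≤ (R i).card * ∑ j ∈ R i, ‖(starRingEnd ℂ) (φ (i, j)) * (A (e j) : l2) i * x j‖ ^ 2 :=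
                sq_sum_le_card_mul_sum_sq
            _ ≤ _ := by
                gcongr with j _
                · exact hcard i
                · rw [norm_mul, norm_mul, mul_pow, mul_pow, mul_assoc]
                  gcongr
                  simpa using hφ (i, j)
      _ ≤ ∑ i ∈ s, N * ∑ j ∈ s.biUnion R, C ^ 2 * (‖(A (e j) : l2) i‖ ^ 2 * ‖x j‖ ^ 2) := by
          gcongr with i hi
          exact Finset.subset_biUnion_of_mem R hi
      _ = N * C ^ 2 * ∑ j ∈ s.biUnion R, (∑ i ∈ s, ‖(A (e j) : l2) i‖ ^ 2) * ‖x j‖ ^ 2 := by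
          rw [← Finset.mul_sum, Finset.sum_comm, mul_assoc, Finset.mul_sum (a := C ^ 2)]
          congr 1
          refine Finset.sum_congr rfl fun j _ => ?_
          rw [← Finset.mul_sum, Finset.sum_mul]
      _ ≤ N * C ^ 2 * ∑ j ∈ s.biUnion R, ‖A‖ ^ 2 * ‖x j‖ ^ 2 := by
          gcongr with j _
          refine (sumsq_le (A (e j)) s).trans ?_
          have := A.le_opNorm (e j)
          rw [norm_e, mul_one] at this
          gcongr
      _ ≤ N * C ^ 2 * (‖A‖ ^ 2 * ‖x‖ ^ 2) := by
          rw [← Finset.mul_sum]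
          gcongr
          exact sumsq_le x _
      _ = (√N * C * ‖A‖ * ‖x‖) ^ 2 := by
          rw [mul_pow, mul_pow, mul_pow, Real.sq_sqrt (by positivity)]; ring
  obtain ⟨B, -, hB⟩ := mkop (fun i j => (starRingEnd ℂ) (φ (i, j)) * (A (e j) : l2) i)
    (fun i => (hfin i).toFinset) (by intro i j h; simp at h; simp [h]) (√N * C * ‖A‖) (by positivity) key
  refine ⟨B, fun i j => ?_⟩
  rw [ent_eq, ent_eq, hB]; simp

theorem ent_adjoint (A : l2 →L[ℂ] l2) (i j : ℕ) :
    ent (ContinuousLinearMap.adjoint A) i j = (starRingEnd ℂ) (ent A j i) := by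
  unfold ent
  rw [ContinuousLinearMap.adjoint_inner_left, inner_conj_symm]

theorem col_schur (φ : ℕ × ℕ → ℂ) (C : ℝ) (hφ : ∀ p, ‖φ p‖ ≤ C) (N : ℕ)
    (hN : ∀ j, {i | φ (i, j) ≠ 0}.encard ≤ N) : IsSchurMultiplier φ := by
  intro A
  obtain ⟨B, hB⟩ := row_schur (fun p => (starRingEnd ℂ) (φ (p.2, p.1))) C
    (by intro p; simpa using hφ (p.2, p.1)) N (by intro i; simpa using hN i)
    (ContinuousLinearMap.adjoint A)
  refine ⟨ContinuousLinearMap.adjoint B, fun i j => ?_⟩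
  rw [ent_adjoint, hB, ent_adjoint]; simp

open Classical in
theorem easy_dir (κ κr κc : Set (ℕ × ℕ)) (N : ℕ) (hκ : κ = κr ∪ κc)
    (hr : ∀ i, {j | (i, j) ∈ κr}.encard ≤ N) (hc : ∀ j, {i | (i, j) ∈ κc}.encard ≤ N)
    (φ : ℕ × ℕ → ℂ) (C : ℝ) (hφ : ∀ p, ‖φ p‖ ≤ C) (h0 : ∀ p ∉ κ, φ p = 0) :
    IsSchurMultiplier φ := by
  intro A
  have hC0 : 0 ≤ C := (norm_nonneg _).trans (hφ (0, 0))
  obtain ⟨B1, h1⟩ := row_schur (fun p => if p ∈ κr then φ p else 0) C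
    (by intro p; split_ifs; exacts [hφ p, by simpa using hC0]) N
    (by intro i
        refine (Set.encard_le_encard ?_).trans (hr i)
        intro j hj
        by_contra hcon
        exact hj (if_neg hcon)) A
  obtain ⟨B2, h2⟩ := col_schur (fun p => if p ∈ κr then 0 else φ p) C
    (by intro p; split_ifs; exacts [by simpa using hC0, hφ p]) N
    (by intro j
        refine (Set.encard_le_encard ?_).trans (hc j)
        intro i hi
        by_contra hcon
        refine hi ?_
        split_ifs with h
        · rfl
        · exact h0 _ (by rw [hκ]; rintro (h' | h'); exacts [h h', hcon h'])) A
  refine ⟨B1 + B2, fun i j => ?_⟩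
  have : ent (B1 + B2) i j = ent B1 i j + ent B2 i j := by
    simp [ent]
  rw [this, h1, h2]
  dsimp only
  split_ifs <;> simp

theorem e_orth : Orthonormal ℂ e := by
  rw [orthonormal_iff_ite]
  intro i j
  conv_lhs => rw [e.eq_def i]
  rw [lp.inner_single_left, e_apply]
  simp

theorem norm_lin {n : ℕ} (x : Fin n → ℝ) (hx : ∑ i, x i ^ 2 ≤ 1) :
    ‖∑ i : Fin n, (x i : ℂ) • e i‖ ≤ 1 := by
  have ho : Orthonormal ℂ (fun i : Fin n => e (i : ℕ)) := e_orth.comp _ Fin.val_injective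
  have h := ho.inner_sum (fun i => (x i : ℂ)) (fun i => (x i : ℂ)) Finset.univ
  rw [inner_self_eq_norm_sq_to_K] at h
  have h2 : ‖∑ i : Fin n, (x i : ℂ) • e i‖ ^ 2 = ∑ i, x i ^ 2 := by
    have h3 : ((‖∑ i : Fin n, (x i : ℂ) • e i‖ ^ 2 : ℝ) : ℂ) = ((∑ i, x i ^ 2 : ℝ) : ℂ) := by
      push_cast
      refine Eq.trans h ?_
      refine Finset.sum_congr rfl fun i _ => ?_
      rw [Complex.conj_ofReal, pow_two]
    exact_mod_cast h3
  rw [← sq_le_one_iff₀ (norm_nonneg _), h2]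
  exact hx

theorem form_bd (B : l2 →L[ℂ] l2) {n : ℕ} (x y : Fin n → ℝ) (hx : ∑ i, x i ^ 2 ≤ 1)
    (hy : ∑ i, y i ^ 2 ≤ 1) :
    ‖∑ i : Fin n, ∑ j : Fin n, (x i : ℂ) * y j * (B (e j) : l2) i‖ ≤ ‖B‖ := by
  have h : ⟪∑ i : Fin n, (x i : ℂ) • e i, B (∑ j : Fin n, (y j : ℂ) • e j)⟫_ℂ =
      ∑ i : Fin n, ∑ j : Fin n, (x i : ℂ) * y j * (B (e j) : l2) i := by
    rw [sum_inner]
    refine Finset.sum_congr rfl fun i _ => ?_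
    rw [map_sum, inner_sum]
    refine Finset.sum_congr rfl fun j _ => ?_
    rw [map_smul, inner_smul_left, inner_smul_right]
    have : ⟪e (i:ℕ), B (e (j:ℕ))⟫_ℂ = (B (e j) : l2) i := by
      conv_lhs => rw [e.eq_def (i:ℕ)]
      rw [lp.inner_single_left]; simp
    rw [this, Complex.conj_ofReal, mul_assoc]
  rw [← h]
  calc _ ≤ ‖∑ i : Fin n, (x i : ℂ) • e i‖ * ‖B (∑ j : Fin n, (y j : ℂ) • e j)‖ := norm_inner_le_norm _ _
    _ ≤ 1 * (‖B‖ * 1) := by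
        gcongr
        · exact norm_lin x hx
        · exact (B.le_opNorm _).trans (by gcongr; exact norm_lin y hy)
    _ = ‖B‖ := by ring

abbrev Idx := {t : (n : ℕ) × ((Fin n → ℝ) × (Fin n → ℝ)) //
  ∑ i, t.2.1 i ^ 2 ≤ 1 ∧ ∑ i, t.2.2 i ^ 2 ≤ 1}

open Classical in
theorem unif (κ : Set (ℕ × ℕ))
    (h : ∀ φ : ℕ × ℕ → ℂ, (∃ C, ∀ p : ℕ × ℕ, ‖φ p‖ ≤ C) → (∀ p ∉ κ, φ p = 0) →
        IsSchurMultiplier φ) :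
    ∃ M : ℝ, ∀ (t : Idx) (Φ : BoundedContinuousFunction (ℕ × ℕ) ℂ) (A : l2 →L[ℂ] l2), ‖Φ‖ ≤ 1 → ‖A‖ ≤ 1 →
      ‖∑ i, ∑ j, (t.1.2.1 i : ℂ) * t.1.2.2 j *
        ((if ((i:ℕ), (j:ℕ)) ∈ κ then Φ (i, j) else 0) * (A (e j) : l2) i)‖ ≤ M := by
  have h1 : ∀ A : l2 →L[ℂ] l2, ∃ C, ∀ (t : Idx) (Φ : BoundedContinuousFunction (ℕ × ℕ) ℂ), ‖Φ‖ ≤ 1 →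
      ‖∑ i, ∑ j, (t.1.2.1 i : ℂ) * t.1.2.2 j *
        ((if ((i:ℕ), (j:ℕ)) ∈ κ then Φ (i, j) else 0) * (A (e j) : l2) i)‖ ≤ C := by
    intro A
    let g : Idx → BoundedContinuousFunction (ℕ × ℕ) ℂ →L[ℂ] ℂ := fun t =>
      ∑ i, ∑ j, ((t.1.2.1 i : ℂ) * t.1.2.2 j *
        ((if ((i:ℕ), (j:ℕ)) ∈ κ then 1 else 0) * (A (e j) : l2) i)) •
          BoundedContinuousFunction.evalCLM ℂ ((i:ℕ), (j:ℕ))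
    have hg : ∀ t Φ, g t Φ = ∑ i, ∑ j, (t.1.2.1 i : ℂ) * t.1.2.2 j *
        ((if ((i:ℕ), (j:ℕ)) ∈ κ then Φ (i, j) else 0) * (A (e j) : l2) i) := by
      intro t Φ
      simp only [g, _root_.sum_apply, _root_.smul_apply,
        BoundedContinuousFunction.evalCLM_apply, smul_eq_mul]
      refine Finset.sum_congr rfl fun i _ => Finset.sum_congr rfl fun j _ => ?_
      split_ifs <;> ring
    obtain ⟨C, hC⟩ := banach_steinhaus (g := g) (by
      intro Φ
      obtain ⟨B, hB⟩ := h (fun p => if p ∈ κ then (starRingEnd ℂ) (Φ p) else 0)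
        ⟨‖Φ‖, fun p => by
          split_ifs
          · simpa using Φ.norm_coe_le_norm p
          · simp⟩ (fun p hp => if_neg hp) A
      refine ⟨‖B‖, fun t => ?_⟩
      rw [hg]
      refine le_trans (le_of_eq ?_) (form_bd B t.1.2.1 t.1.2.2 t.2.1 t.2.2)
      congr 1
      refine Finset.sum_congr rfl fun i _ => Finset.sum_congr rfl fun j _ => ?_
      congr 1
      have := congrArg (starRingEnd ℂ) (hB i j)
      rw [ent_eq, ent_eq] at this
      rw [map_mul] at this
      simp only [Complex.conj_conj] at this
      rw [this]
      congr 1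
      split_ifs <;> simp)
    refine ⟨C, fun t Φ hΦ => ?_⟩
    rw [← hg]
    refine ((g t).le_opNorm Φ).trans ?_
    calc ‖g t‖ * ‖Φ‖ ≤ C * 1 := mul_le_mul (hC t) hΦ (norm_nonneg _) ((norm_nonneg _).trans (hC t))
      _ = C := mul_one _
  let g : Idx × {Φ : BoundedContinuousFunction (ℕ × ℕ) ℂ // ‖Φ‖ ≤ 1} → (l2 →L[ℂ] l2) →L[ℂ] ℂ := fun t =>
      ∑ i, ∑ j, ((t.1.1.2.1 i : ℂ) * t.1.1.2.2 j *
        (if ((i:ℕ), (j:ℕ)) ∈ κ then t.2.1 ((i:ℕ), (j:ℕ)) else 0)) •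
          ((lp.evalCLM ℂ (fun _ : ℕ => ℂ) 2 (i:ℕ)).comp (ContinuousLinearMap.apply ℂ l2 (e j)))
  have hg : ∀ t A, g t A = ∑ i, ∑ j, (t.1.1.2.1 i : ℂ) * t.1.1.2.2 j *
        ((if ((i:ℕ), (j:ℕ)) ∈ κ then t.2.1 (i, j) else 0) * (A (e j) : l2) i) := by
    intro t A
    simp only [g, _root_.sum_apply, _root_.smul_apply, smul_eq_mul]
    refine Finset.sum_congr rfl fun i _ => Finset.sum_congr rfl fun j _ => ?_
    rw [mul_assoc]; rfl
  obtain ⟨C, hC⟩ := banach_steinhaus (g := g) (by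
      intro A
      obtain ⟨C, hC⟩ := h1 A
      refine ⟨C, fun t => ?_⟩
      rw [hg]
      exact hC t.1 t.2.1 t.2.2)
  refine ⟨C, fun t Φ A hΦ hA => ?_⟩
  have := hg (t, ⟨Φ, hΦ⟩) A
  rw [← this]
  refine ((g (t, ⟨Φ, hΦ⟩)).le_opNorm A).trans ?_
  calc _ ≤ C * 1 := mul_le_mul (hC _) hA (norm_nonneg _) ((norm_nonneg _).trans (hC (t, ⟨Φ, hΦ⟩)))
    _ = C := mul_one _

theorem ext_op {n : ℕ} (Y : Matrix (Fin n) (Fin n) ℝ) (hY : ∀ v, (Y *ᵥ v) ⬝ᵥ (Y *ᵥ v) ≤ v ⬝ᵥ v) :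
    ∃ A : l2 →L[ℂ] l2, ‖A‖ ≤ 1 ∧ ∀ i j : Fin n, (A (e j) : l2) i = Y i j := by
  let b : ℕ → ℕ → ℂ := fun i j => if h : i < n ∧ j < n then (Y ⟨i, h.1⟩ ⟨j, h.2⟩ : ℂ) else 0
  have hb : ∀ i j : Fin n, b i j = Y i j := by
    intro i j; simp [b]
  obtain ⟨A, hA, hA2⟩ := mkop b (fun _ => Finset.range n) (by
    intro i j hj
    simp at hj
    simp [b, hj]) 1 zero_le_one (by
    intro x s
    have h0 : ∀ i, i ∉ Finset.range n → ‖∑ j ∈ Finset.range n, b i j * x j‖ ^ 2 = 0 := by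
      intro i hi
      simp at hi
      simp [b, hi.not_gt]
    calc ∑ i ∈ s, ‖∑ j ∈ Finset.range n, b i j * x j‖ ^ 2
        ≤ ∑ i ∈ s ∪ Finset.range n, ‖∑ j ∈ Finset.range n, b i j * x j‖ ^ 2 :=
          Finset.sum_le_sum_of_subset_of_nonneg Finset.subset_union_left fun _ _ _ => sq_nonneg _
      _ = ∑ i ∈ Finset.range n, ‖∑ j ∈ Finset.range n, b i j * x j‖ ^ 2 :=
          (Finset.sum_subset Finset.subset_union_right fun i _ hi => h0 i hi).symm
      _ = ∑ i : Fin n, ‖∑ j : Fin n, (Y i j : ℂ) * x j‖ ^ 2 := by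
          rw [Finset.sum_range]
          refine Finset.sum_congr rfl fun i _ => ?_
          rw [Finset.sum_range]
          simp_rw [hb]
      _ = (Y *ᵥ fun j => (x j).re) ⬝ᵥ (Y *ᵥ fun j => (x j).re) +
          (Y *ᵥ fun j => (x j).im) ⬝ᵥ (Y *ᵥ fun j => (x j).im) := by
          simp only [dotProduct, mulVec]
          rw [← Finset.sum_add_distrib]
          refine Finset.sum_congr rfl fun i _ => ?_
          rw [← Complex.normSq_eq_norm_sq, Complex.normSq_apply]
          simp
      _ ≤ (fun j : Fin n => (x j).re) ⬝ᵥ (fun j : Fin n => (x j).re) +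
          (fun j : Fin n => (x j).im) ⬝ᵥ (fun j : Fin n => (x j).im) := add_le_add (hY _) (hY _)
      _ = ∑ j : Fin n, ‖x j‖ ^ 2 := by
          simp only [dotProduct]
          rw [← Finset.sum_add_distrib]
          refine Finset.sum_congr rfl fun i _ => ?_
          rw [← Complex.normSq_eq_norm_sq, Complex.normSq_apply]
      _ = ∑ j ∈ Finset.range n, ‖x j‖ ^ 2 := by rw [Finset.sum_range]
      _ ≤ ‖x‖ ^ 2 := sumsq_le x _
      _ = (1 * ‖x‖) ^ 2 := by rw [one_mul])
  exact ⟨A, hA, fun i j => by rw [hA2, hb]⟩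

theorem getM (κ : Set (ℕ × ℕ))
    (h : ∀ φ : ℕ × ℕ → ℂ, (∃ C, ∀ p : ℕ × ℕ, ‖φ p‖ ≤ C) → (∀ p ∉ κ, φ p = 0) →
        IsSchurMultiplier φ) : ∃ M, HypM κ M := by
  obtain ⟨M, hM⟩ := unif κ h
  refine ⟨M, ?_⟩
  intro n s hs hs0 Y hY x y hx hy
  obtain ⟨A, hA1, hA2⟩ := ext_op Y hY
  let f : ℕ × ℕ → ℂ := fun p => if h : p.1 < n ∧ p.2 < n then (s ⟨p.1, h.1⟩ ⟨p.2, h.2⟩ : ℂ) else 0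
  have hf : ∀ p, ‖f p‖ ≤ 1 := by
    intro p
    simp only [f]
    split_ifs
    · rw [Complex.norm_real]; exact hs _ _
    · simp
  let Φ := BoundedContinuousFunction.ofNormedAddCommGroupDiscrete f 1 hf
  have hΦ : ‖Φ‖ ≤ 1 := (BoundedContinuousFunction.norm_le zero_le_one).2 hf
  have hΦ2 : ∀ i j : Fin n, Φ ((i:ℕ), (j:ℕ)) = s i j := by
    intro i j
    have : Φ ((i:ℕ), (j:ℕ)) = f (i, j) := rfl
    rw [this]; simp [f]
  have := hM ⟨⟨n, x, y⟩, hx, hy⟩ Φ A hΦ hA1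
  refine le_trans ?_ this
  refine (le_abs_self _).trans (le_of_eq ?_)
  rw [← Real.norm_eq_abs, ← Complex.norm_real]
  congr 1
  push_cast
  refine Finset.sum_congr rfl fun i _ => Finset.sum_congr rfl fun j _ => ?_
  rw [hA2, hΦ2]
  split_ifs with hij
  · ring
  · rw [hs0 i j hij]; simp

/-- Davidson–Donsig: A set `κ ⊆ ℕ × ℕ` is a Schur bounded pattern (every
bounded function supported on `κ` is a Schur multiplier) if and only if `κ = κ_r ∪ κ_c`
where, for some `N`, every row of `κ_r` and every column of `κ_c` has at most `N`
entries. -/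
theorem davidson_donsig (κ : Set (ℕ × ℕ)) :
    (∀ φ : ℕ × ℕ → ℂ, (∃ C, ∀ p : ℕ × ℕ, ‖φ p‖ ≤ C) → (∀ p ∉ κ, φ p = 0) →
        IsSchurMultiplier φ)
    ↔ ∃ (κr κc : Set (ℕ × ℕ)) (N : ℕ), κ = κr ∪ κc ∧
        (∀ i, {j | (i, j) ∈ κr}.encard ≤ N) ∧
        (∀ j, {i | (i, j) ∈ κc}.encard ≤ N) := by
  constructor
  · intro h
    obtain ⟨M, hM⟩ := getM κ h
    obtain ⟨K, hK⟩ := lowdeg κ (2 * M) (limQ κ M hM)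
    exact compactness κ K fun H hH => decomp κ K hK _ H rfl hH
  · rintro ⟨κr, κc, N, hκ, hr, hc⟩ φ ⟨C, hC⟩ h0
    exact easy_dir κ κr κc N hκ hr hc φ C hC h0

end
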